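/- arXiv:1508.04052 — 4 statements merged into one kernel-verified Lean document; each statement's English description precedes it below -/
import Mathlib

section
/- Let τ be a real number with 0 < τ ≤ 2 and let g : ℝ → ℝ be continuous on [0, τ], nonnegative on [0, τ], and antitone (monotonically decreasing) on [0, τ]. Assume moreover that either (τ < 2 and g(0) > 0) or g(0) > g(τ). Then ∫₀^τ (1 − x)·g(x) dx > 0. -/
open MeasureTheory intervalIntegral

/-- Strict analytic core of Lemma 8.4 (conv_lem), stable case: if `0 < τ ≤ 2`,
`g` is continuous, nonnegative and antitone on `[0, τ]`, and moreover either
(`τ < 2` and `g 0 > 0`) or `g 0 > g τ`, then `∫₀^τ (1 - x)·g x dx > 0`. -/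
theorem stmt_2 (τ : ℝ) (hτ0 : 0 < τ) (hτ2 : τ ≤ 2) (g : ℝ → ℝ)
    (hgc : ContinuousOn g (Set.Icc 0 τ))
    (hg0 : ∀ x ∈ Set.Icc (0:ℝ) τ, 0 ≤ g x)
    (hanti : AntitoneOn g (Set.Icc 0 τ))
    (hne : (τ < 2 ∧ 0 < g 0) ∨ g τ < g 0) :
    0 < ∫ x in (0:ℝ)..τ, (1 - x) * g x := by
  have h0 : (0:ℝ) ∈ Set.Icc 0 τ := ⟨le_rfl, hτ0.le⟩
  have h1 : τ ∈ Set.Icc 0 τ := ⟨hτ0.le, le_rfl⟩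
  have hm : τ / 2 ∈ Set.Icc 0 τ := ⟨by linarith, by linarith⟩
  have hmean : ∫ x in (0:ℝ)..τ, (τ / 2 - x) * g (τ / 2) = 0 := by
    rw [intervalIntegral.integral_mul_const,
      intervalIntegral.integral_sub (by simp) (by simp)]
    simp only [intervalIntegral.integral_const, integral_id, smul_eq_mul]
    ring
  have hcont : ContinuousOn (fun x => (1 - x) * g x) (Set.Icc 0 τ) := by fun_prop
  have hlin : Continuous fun x : ℝ => (τ / 2 - x) * g (τ / 2) := by fun_prop
  have hshift : ∫ x in (0:ℝ)..τ, (1 - x) * g x =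
      ∫ x in (0:ℝ)..τ, ((1 - x) * g x - (τ / 2 - x) * g (τ / 2)) := by
    rw [intervalIntegral.integral_sub (hcont.intervalIntegrable_of_Icc hτ0.le)
      (hlin.intervalIntegrable _ _), hmean, sub_zero]
  have hsplit : ∀ x, (1 - x) * g x - (τ / 2 - x) * g (τ / 2) =
      (1 - τ / 2) * g x + (τ / 2 - x) * (g x - g (τ / 2)) := fun x => by ring
  have hfst : ∀ x ∈ Set.Icc 0 τ, 0 ≤ (1 - τ / 2) * g x := fun x hx =>
    mul_nonneg (by linarith) (hg0 x hx)
  have hsnd : ∀ x ∈ Set.Icc 0 τ, 0 ≤ (τ / 2 - x) * (g x - g (τ / 2)) := by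
    intro x hx
    rcases le_total x (τ / 2) with h | h
    · exact mul_nonneg (by linarith) (by linarith [hanti hx hm h])
    · exact mul_nonneg_of_nonpos_of_nonpos (by linarith) (by linarith [hanti hm hx h])
  rw [hshift]
  refine intervalIntegral.integral_pos hτ0 (hcont.sub hlin.continuousOn) (fun x hx => ?_) ?_
  · rw [hsplit]
    exact add_nonneg (hfst x (Set.Ioc_subset_Icc_self hx)) (hsnd x (Set.Ioc_subset_Icc_self hx))
  · simp only [hsplit]
    rcases hne with ⟨hτ, hpos⟩ | hlt
    · exact ⟨0, h0, add_pos_of_pos_of_nonneg (mul_pos (by linarith) hpos) (hsnd 0 h0)⟩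
    · rcases lt_or_ge (g (τ / 2)) (g 0) with h | h
      · exact ⟨0, h0, add_pos_of_nonneg_of_pos (hfst 0 h0)
          (mul_pos (by linarith) (by linarith))⟩
      · exact ⟨τ, h1, add_pos_of_nonneg_of_pos (hfst τ h1)
          (mul_pos_of_neg_of_neg (by linarith) (by linarith))⟩
end

section
/- Let τ be a real number with τ ≥ 2 and let g : ℝ → ℝ be continuous on [0, τ], nonnegative on [0, τ], and monotone (monotonically increasing) on [0, τ]. Assume moreover that either (τ > 2 and g(τ) > 0) or g(0) < g(τ). Then ∫₀^τ (1 − x)·g(x) dx < 0. -/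
open MeasureTheory intervalIntegral

/-- Strict analytic core of the reverse direction of Lemma 8.4 (conv_lem): if
`τ ≥ 2`, `g` is continuous, nonnegative and monotone increasing on `[0, τ]`,
and moreover either (`τ > 2` and `g τ > 0`) or `g 0 < g τ`, then
`∫₀^τ (1 - x)·g x dx < 0`. -/
theorem stmt_4 (τ : ℝ) (hτ2 : 2 ≤ τ) (g : ℝ → ℝ)
    (hgc : ContinuousOn g (Set.Icc 0 τ))
    (hg0 : ∀ x ∈ Set.Icc (0:ℝ) τ, 0 ≤ g x)
    (hmono : MonotoneOn g (Set.Icc 0 τ))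
    (hne : (2 < τ ∧ 0 < g τ) ∨ g 0 < g τ) :
    (∫ x in (0:ℝ)..τ, (1 - x) * g x) < 0 := by
  have h0 : (0:ℝ) ∈ Set.Icc 0 τ := ⟨le_rfl, by linarith⟩
  have h1 : (1:ℝ) ∈ Set.Icc 0 τ := ⟨by norm_num, by linarith⟩
  have hτ : τ ∈ Set.Icc 0 τ := ⟨by linarith, le_rfl⟩
  have hle : ∀ x ∈ Set.Icc 0 τ, (1 - x) * g x ≤ (1 - x) * g 1 := by
    intro x hx
    rcases le_total x 1 with h | h
    · exact mul_le_mul_of_nonneg_left (hmono hx h1 h) (by linarith)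
    · exact mul_le_mul_of_nonpos_left (hmono h1 hx h) (by linarith)
  have hc : ContinuousOn (fun x => (1 - x) * g x) (Set.Icc 0 τ) :=
    (by fun_prop : Continuous fun x : ℝ => 1 - x).continuousOn.mul hgc
  have hc1 : Continuous fun x : ℝ => (1 - x) * g 1 := by fun_prop
  have hint : (∫ x in (0:ℝ)..τ, (1 - x) * g 1) = (τ - τ ^ 2 / 2) * g 1 := by
    rw [intervalIntegral.integral_mul_const,
      intervalIntegral.integral_sub (by simp) (by simp)]
    simp
  have hg1 := hg0 1 h1
  have hnonpos : (τ - τ ^ 2 / 2) * g 1 ≤ 0 :=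
    mul_nonpos_of_nonpos_of_nonneg (by nlinarith) hg1
  have hstrict : (∃ x ∈ Set.Icc 0 τ, (1 - x) * g x < (1 - x) * g 1) →
      (∫ x in (0:ℝ)..τ, (1 - x) * g x) < 0 := fun h =>
    (intervalIntegral.integral_lt_integral_of_continuousOn_of_le_of_exists_lt
      (by linarith) hc hc1.continuousOn
      (fun x hx => hle x (Set.Ioc_subset_Icc_self hx)) h).trans_le (hint.trans_le hnonpos)
  rcases lt_or_ge (g 1) (g τ) with h | h
  · exact hstrict ⟨τ, hτ, by nlinarith⟩
  · rcases hne with ⟨ht, hpos⟩ | hlt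
    · have hmonoInt : (∫ x in (0:ℝ)..τ, (1 - x) * g x) ≤ ∫ x in (0:ℝ)..τ, (1 - x) * g 1 :=
        intervalIntegral.integral_mono_on hτ.1
          (hc.intervalIntegrable_of_Icc hτ.1) (hc1.intervalIntegrable 0 τ) hle
      refine (hmonoInt.trans_eq hint).trans_lt ?_
      exact mul_neg_of_neg_of_pos (by nlinarith) (hpos.trans_le h)
    · exact hstrict ⟨0, h0, by linarith⟩
end

section
/- Let n ≥ 2 be an integer and r > 0 a real number, and define g₁ : ℝ → ℝ by g₁(x) = (r^{n+1} − (n·x + r)·(r − x)^n)/x². Then g₁ is strictly decreasing on the open interval (0, r): for all real x, y with 0 < x < y < r, one has g₁(y) < g₁(x). -/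
/-- Raising the exponent multiplies the quotient by `r` and adds `(n + 1) (r - x) ^ n`. -/
theorem quotient_succ (n : ℕ) (r : ℝ) {x : ℝ} (hx : x ≠ 0) :
    (r ^ (n + 1 + 1) - (((n + 1 : ℕ) : ℝ) * x + r) * (r - x) ^ (n + 1)) / x ^ 2 =
      r * ((r ^ (n + 1) - ((n : ℝ) * x + r) * (r - x) ^ n) / x ^ 2) +
        ((n : ℝ) + 1) * (r - x) ^ n := by
  field_simp
  push_cast
  ring

/-- Key analytic claim inside Lemma 8.7 (rhothree_lem): for `n ≥ 2` and `r > 0`,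
the function `g₁ x = (r^(n+1) - (n·x + r)·(r - x)^n) / x²` is strictly
decreasing on the open interval `(0, r)`. -/
theorem stmt_6 (n : ℕ) (hn : 2 ≤ n) (r : ℝ) (hr : 0 < r) :
    ∀ x y : ℝ, 0 < x → x < y → y < r →
      (r ^ (n + 1) - ((n : ℝ) * y + r) * (r - y) ^ n) / y ^ 2 <
        (r ^ (n + 1) - ((n : ℝ) * x + r) * (r - x) ^ n) / x ^ 2 := by
  intro x y hx hxy hyr
  have hy : 0 < y := hx.trans hxy
  induction n, hn using Nat.le_induction with
  | base =>
    have quotient_two (z : ℝ) (hz : z ≠ 0) :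
        (r ^ (2 + 1) - (((2 : ℕ) : ℝ) * z + r) * (r - z) ^ 2) / z ^ 2 = 3 * r - 2 * z := by
      field_simp
      push_cast
      ring
    rw [quotient_two x hx.ne', quotient_two y hy.ne']
    linarith
  | succ n hn ih =>
    rw [quotient_succ n r hx.ne', quotient_succ n r hy.ne']
    have hry : 0 ≤ r - y := by linarith
    gcongr
end

section
/- Let n ≥ 2 be an integer and let r, s, s' be real numbers with 0 < s' < s < r. Then (r^{n+1} − (n·s + r)·(r − s)^n)/s² < (r^{n+1} − (n·s' + r)·(r − s')^n)/s'². -/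
theorem div_sq_succ (n : ℕ) (r x : ℝ) (hx : x ≠ 0) :
    (r ^ (n + 1 + 1) - (((n + 1 : ℕ) : ℝ) * x + r) * (r - x) ^ (n + 1)) / x ^ 2 =
      r * ((r ^ (n + 1) - ((n : ℝ) * x + r) * (r - x) ^ n) / x ^ 2) +
        ((n : ℝ) + 1) * (r - x) ^ n := by
  field_simp
  push_cast
  ring


/-- Sign computation in Lemma 8.7 (rhothree_lem): for `n ≥ 2` and reals
`0 < s' < s < r`, one has `g₁ s < g₁ s'` for
`g₁ x = (r^(n+1) - (n·x + r)·(r - x)^n) / x²`. -/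
theorem stmt_8 (n : ℕ) (hn : 2 ≤ n) (r s s' : ℝ)
    (h0 : 0 < s') (h1 : s' < s) (h2 : s < r) :
    (r ^ (n + 1) - ((n : ℝ) * s + r) * (r - s) ^ n) / s ^ 2 <
      (r ^ (n + 1) - ((n : ℝ) * s' + r) * (r - s') ^ n) / s' ^ 2 := by
  have hs : 0 < s := h0.trans h1
  have hr : 0 < r := hs.trans h2
  induction n, hn using Nat.le_induction with
  | base =>
    have key : ∀ x : ℝ, x ≠ 0 →
        (r ^ (2 + 1) - (((2 : ℕ) : ℝ) * x + r) * (r - x) ^ 2) / x ^ 2 = 3 * r - 2 * x := by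
      intro x hx
      field_simp
      push_cast
      ring
    rw [key s hs.ne', key s' h0.ne']
    linarith
  | succ n _ ih =>
    rw [div_sq_succ n r s hs.ne', div_sq_succ n r s' h0.ne']
    have hpow : (r - s) ^ n ≤ (r - s') ^ n :=
      pow_le_pow_left₀ (by linarith) (by linarith) n
    have h3 := mul_lt_mul_of_pos_left ih hr
    have h4 := mul_le_mul_of_nonneg_left hpow (by positivity : (0 : ℝ) ≤ (n : ℝ) + 1)
    linarith
end
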